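/- arXiv:2202.02780 — 2 statements merged into one kernel-verified Lean document; each statement's English description precedes it below -/
import Mathlib

section
/- Let p be an odd prime and suppose A, B ⊆ 𝔽_p satisfy A + B = R_p with 2 ≤ |A| ≤ |B|, where R_p is the set of nonzero quadratic residues mod p. Then |A| ≥ 5. -/
open scoped Pointwise

def Rp (p : ℕ) [NeZero p] : Finset (ZMod p) :=
  Finset.univ.filter fun x => x ≠ 0 ∧ IsSquare x

open Polynomial in
theorem qr_moment {K : Type*} [Field K] [DecidableEq K] (A : Finset K) (hA : 1 ≤ A.card) (x : K)
    (k : ℕ) (hk : k ≤ A.card - 1) :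
    ∑ a ∈ A, Lagrange.nodalWeight A id a * (x - a) ^ k
      = if k = A.card - 1 then (-1) ^ k else 0 := by
  have hdeg : ((X - C x : K[X]) ^ k).natDegree = k := by
    rw [natDegree_pow, natDegree_X_sub_C, mul_one]
  have h := Lagrange.coeff_eq_sum (s := A) (v := id) (Set.injOn_id _) (P := (X - C x) ^ k) (by
    refine lt_of_le_of_lt degree_le_natDegree ?_
    rw [hdeg]; exact_mod_cast (by omega))
  have h2 : ((X - C x : K[X]) ^ k).coeff (A.card - 1) = if k = A.card - 1 then 1 else 0 := by
    split_ifs with hh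
    · rw [← hh]
      have := ((monic_X_sub_C x).pow k).coeff_natDegree
      rwa [hdeg] at this
    · apply coeff_eq_zero_of_natDegree_lt
      rw [hdeg]; omega
  have h3 : ∑ a ∈ A, Lagrange.nodalWeight A id a * (x - a) ^ k
      = (-1) ^ k * ((X - C x : K[X]) ^ k).coeff (A.card - 1) := by
    rw [h, Finset.mul_sum]
    refine Finset.sum_congr rfl fun a _ => ?_
    rw [Lagrange.nodalWeight, Finset.prod_inv_distrib, div_eq_mul_inv]
    simp only [eval_pow, eval_sub, eval_X, eval_C, id]
    rw [show x - a = (-1) * (a - x) by ring, mul_pow]; ring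
  rw [h3, h2]; split_ifs <;> simp

open Polynomial in
/-- The Hanson-Petridis (Stepanov) auxiliary polynomial. -/
noncomputable def qrF {K : Type*} [Field K] [DecidableEq K] (A : Finset K) (N : ℕ) : K[X] :=
  ∑ a ∈ A, C (Lagrange.nodalWeight A id a) * (X - C a) ^ (N + (A.card - 1)) - C ((-1) ^ (A.card - 1))

open Polynomial in
theorem qrF_taylor {K : Type*} [Field K] [DecidableEq K] (A : Finset K) (N : ℕ) (b : K) (k : ℕ) :
    (taylor b (qrF A N)).coeff k =
      (∑ a ∈ A, Lagrange.nodalWeight A id a * (b - a) ^ (N + (A.card - 1) - k)) *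
        ((N + (A.card - 1)).choose k : K) - if k = 0 then (-1) ^ (A.card - 1) else 0 := by
  rw [qrF, map_sub, map_sum, taylor_C, coeff_sub, finsetSum_coeff, coeff_C, Finset.sum_mul]
  congr 1
  refine Finset.sum_congr rfl fun a _ => ?_
  rw [taylor_mul, taylor_pow, map_sub, taylor_C, taylor_C, taylor_X, coeff_C_mul,
    show (X + C b - C a : K[X]) = X + C (b - a) by rw [C_sub]; ring, coeff_X_add_C_pow, mul_assoc]

open Polynomial in
theorem qrF_coeff {K : Type*} [Field K] [DecidableEq K] (A : Finset K) (N : ℕ) (k : ℕ) :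
    (qrF A N).coeff k =
      (∑ a ∈ A, Lagrange.nodalWeight A id a * (0 - a) ^ (N + (A.card - 1) - k)) *
        ((N + (A.card - 1)).choose k : K) - if k = 0 then (-1) ^ (A.card - 1) else 0 := by
  rw [← qrF_taylor]; simp

open Polynomial in
theorem qrF_natDegree_le {K : Type*} [Field K] [DecidableEq K] (A : Finset K) (hA : 1 ≤ A.card)
    (N : ℕ) : (qrF A N).natDegree ≤ N := by
  rw [natDegree_le_iff_coeff_eq_zero]
  intro k hk
  rw [qrF_coeff, if_neg (by omega), sub_zero]
  by_cases h : k ≤ N + (A.card - 1)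
  · rw [qr_moment A hA _ _ (by omega), if_neg (by omega), zero_mul]
  · rw [Nat.choose_eq_zero_of_lt (by omega)]; simp

theorem qr_choose_ne_zero (p : ℕ) [Fact p.Prime] (n k : ℕ) (hn : n < p) (hk : k ≤ n) :
    ((n.choose k : ℕ) : ZMod p) ≠ 0 := by
  rw [Ne, ZMod.natCast_eq_zero_iff]
  intro h
  have h1 : p ∣ n.factorial := by
    rw [← Nat.choose_mul_factorial_mul_factorial hk, mul_assoc]; exact h.mul_right _
  have := (Nat.Prime.dvd_factorial Fact.out).1 h1
  omega

open Polynomial in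
theorem qrF_coeff_N {p : ℕ} [Fact p.Prime] (A : Finset (ZMod p)) (hA : 1 ≤ A.card)
    (N : ℕ) (hN : 1 ≤ N) (hp : N + (A.card - 1) < p) : (qrF A N).coeff N ≠ 0 := by
  rw [qrF_coeff, if_neg (by omega), sub_zero, qr_moment A hA _ _ (by omega), if_pos (by omega)]
  exact mul_ne_zero (pow_ne_zero _ (by simp)) (qr_choose_ne_zero p _ _ hp (by omega))

open Polynomial in
theorem qrF_dvd {K : Type*} [Field K] [DecidableEq K] (A B : Finset K) (hA : 1 ≤ A.card)
    (N : ℕ) (h : ∀ a ∈ A, ∀ b ∈ B, (b - a) ^ N = 1) :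
    (Lagrange.nodal B id) ^ A.card ∣ qrF A N := by
  rw [Lagrange.nodal, ← Finset.prod_pow]
  apply Finset.prod_dvd_of_coprime
  · intro b _ b' _ hbb
    exact (pairwise_coprime_X_sub_C Function.injective_id hbb).pow
  · intro b hb
    have : X ^ A.card ∣ taylor b (qrF A N) := by
      rw [X_pow_dvd_iff]
      intro k hk
      rw [qrF_taylor]
      have : ∑ a ∈ A, Lagrange.nodalWeight A id a * (b - a) ^ (N + (A.card - 1) - k)
        = ∑ a ∈ A, Lagrange.nodalWeight A id a * (b - a) ^ (A.card - 1 - k) := by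
        refine Finset.sum_congr rfl fun a ha => ?_
        rw [show N + (A.card - 1) - k = N + (A.card - 1 - k) by omega, pow_add, h a ha b hb, one_mul]
      rw [this, qr_moment A hA _ _ (by omega)]
      rcases Nat.eq_zero_or_pos k with rfl | hk0
      · simp
      · rw [if_neg (by omega), if_neg (by omega)]; simp
    obtain ⟨q, hq⟩ := this
    refine ⟨taylor (-b) q, ?_⟩
    apply taylor_injective b
    rw [hq, taylor_mul, taylor_taylor, taylor_pow]
    simp
    
open Polynomial in
/-- Hanson-Petridis bound, with the equality case. -/
theorem qr_HP {p : ℕ} [Fact p.Prime] (A B : Finset (ZMod p)) (hA : 1 ≤ A.card)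
    (N : ℕ) (hN : 1 ≤ N) (hp : N + (A.card - 1) < p) (h : ∀ a ∈ A, ∀ b ∈ B, (b - a) ^ N = 1) :
    A.card * B.card ≤ N ∧ (A.card * B.card = N →
      ∃ c : ZMod p, c ≠ 0 ∧ qrF A N = C c * (Lagrange.nodal B id) ^ A.card) := by
  have hd := qrF_dvd A B hA N h
  have hne : qrF A N ≠ 0 := fun h0 => qrF_coeff_N A hA N hN hp (by rw [h0]; simp)
  have hdeg := qrF_natDegree_le A hA N
  have hnd : ((Lagrange.nodal B (id : ZMod p → ZMod p)) ^ A.card).natDegree = A.card * B.card := by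
    rw [natDegree_pow, Lagrange.natDegree_nodal]
  refine ⟨?_, ?_⟩
  · rw [← hnd]; exact (natDegree_le_of_dvd hd hne).trans hdeg
  · intro he
    obtain ⟨q, hq⟩ := hd
    have hq0 : q ≠ 0 := by rintro rfl; exact hne (by rw [hq]; simp)
    have hn0 : (Lagrange.nodal B (id : ZMod p → ZMod p)) ^ A.card ≠ 0 := pow_ne_zero _ Lagrange.nodal_ne_zero
    have : q.natDegree = 0 := by
      have := natDegree_mul hn0 hq0
      rw [← hq, hnd] at this; omega
    rw [natDegree_eq_zero] at this
    obtain ⟨c, rfl⟩ := this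
    refine ⟨c, ?_, by rw [hq]; ring⟩
    rintro rfl; simp at hq0

open Polynomial in
theorem qr_sigma {K : Type*} [Field K] [DecidableEq K] (A : Finset K) (hA : A.Nonempty) (x : K)
    (hx : ∀ a ∈ A, x ≠ a) :
    (Lagrange.nodal A id).eval x * (∑ a ∈ A, Lagrange.nodalWeight A id a * ((x - a)⁻¹)) = 1 ∧
    (derivative (Lagrange.nodal A id)).eval x *
        (∑ a ∈ A, Lagrange.nodalWeight A id a * ((x - a)⁻¹)) =
      (Lagrange.nodal A id).eval x * (∑ a ∈ A, Lagrange.nodalWeight A id a * ((x - a)⁻¹) ^ 2) ∧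
    2 * (Lagrange.nodal A id).eval x * (∑ a ∈ A, Lagrange.nodalWeight A id a * ((x - a)⁻¹) ^ 3) =
      2 * (derivative (Lagrange.nodal A id)).eval x *
        (∑ a ∈ A, Lagrange.nodalWeight A id a * ((x - a)⁻¹) ^ 2) -
      (derivative (derivative (Lagrange.nodal A id))).eval x *
        (∑ a ∈ A, Lagrange.nodalWeight A id a * ((x - a)⁻¹)) := by
  set g := Lagrange.nodal A (id : K → K) with hg
  have h0 : ∑ a ∈ A, C (Lagrange.nodalWeight A id a) * Lagrange.nodal (A.erase a) (id : K → K) = 1 := by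
    rw [← Lagrange.sum_basis (s := A) (v := id) (Set.injOn_id _) hA]
    refine Finset.sum_congr rfl fun a ha => ?_
    rw [Lagrange.basis_eq_prod_sub_inv_mul_nodal_div ha, Lagrange.nodal_erase_eq_nodal_div ha]
  have h1 := congrArg derivative h0
  have h2 := congrArg derivative h1
  have e0 := congrArg (eval x) h0
  have e1 := congrArg (eval x) h1
  have e2 := congrArg (eval x) h2
  simp only [derivative_sum, derivative_C_mul, derivative_one, eval_finsetSum, eval_mul, eval_C,
    eval_one, eval_zero, derivative_zero] at e0 e1 e2
  have k0 : ∀ a ∈ A, g = (X - C a) * Lagrange.nodal (A.erase a) id :=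
    fun a ha => Lagrange.nodal_eq_mul_nodal_erase (v := id) ha
  have E0 : ∀ a ∈ A, eval x (Lagrange.nodal (A.erase a) id) = eval x g * (x - a)⁻¹ := by
    intro a ha
    have := congrArg (eval x) (k0 a ha)
    have hne := sub_ne_zero.2 (hx a ha)
    simp at this
    rw [this]; field_simp
  have E1 : ∀ a ∈ A, eval x (derivative (Lagrange.nodal (A.erase a) id)) =
      eval x (derivative g) * (x - a)⁻¹ - eval x g * ((x - a)⁻¹) ^ 2 := by
    intro a ha
    have := congrArg (fun q => eval x (derivative q)) (k0 a ha)
    have hne := sub_ne_zero.2 (hx a ha)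
    simp at this
    rw [E0 a ha] at this
    rw [this]; field_simp; ring
  have E2 : ∀ a ∈ A, eval x (derivative (derivative (Lagrange.nodal (A.erase a) id))) =
      eval x (derivative (derivative g)) * (x - a)⁻¹ - 2 * eval x (derivative g) * ((x - a)⁻¹) ^ 2
       + 2 * eval x g * ((x - a)⁻¹) ^ 3 := by
    intro a ha
    have := congrArg (fun q => eval x (derivative (derivative q))) (k0 a ha)
    have hne := sub_ne_zero.2 (hx a ha)
    simp at this
    rw [E1 a ha] at this
    rw [this]; field_simp; ring
  refine ⟨?_, ?_, ?_⟩
  · rw [← e0, Finset.mul_sum]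
    refine Finset.sum_congr rfl fun a ha => ?_
    rw [E0 a ha]; ring
  · rw [← sub_eq_zero, ← e1, Finset.mul_sum, Finset.mul_sum, ← Finset.sum_sub_distrib]
    refine Finset.sum_congr rfl fun a ha => ?_
    rw [E1 a ha]; ring
  · rw [← sub_eq_zero, ← e2, Finset.mul_sum, Finset.mul_sum, Finset.mul_sum,
      ← Finset.sum_sub_distrib, ← Finset.sum_sub_distrib]
    refine Finset.sum_congr rfl fun a ha => ?_
    rw [E2 a ha]; ring

open Polynomial in
theorem qr_coeff_pow {K : Type*} [Field K] (h : K[X]) (n : ℕ) :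
    (h ^ n).coeff 0 = h.coeff 0 ^ n ∧
    h.coeff 0 * (h ^ n).coeff 1 = n * h.coeff 0 ^ n * h.coeff 1 ∧
    2 * h.coeff 0 ^ 2 * (h ^ n).coeff 2 =
      h.coeff 0 ^ n * (2 * n * h.coeff 0 * h.coeff 2 + n * (n - 1) * h.coeff 1 ^ 2) := by
  induction n with
  | zero => simp [coeff_one]
  | succ n ih =>
    obtain ⟨i0, i1, i2⟩ := ih
    have c1 : (h ^ n * h).coeff 1 = (h ^ n).coeff 0 * h.coeff 1 + (h ^ n).coeff 1 * h.coeff 0 := by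
      rw [coeff_mul]; simp [Finset.Nat.antidiagonal_succ]
    have c2 : (h ^ n * h).coeff 2 = (h ^ n).coeff 0 * h.coeff 2 + (h ^ n).coeff 1 * h.coeff 1
        + (h ^ n).coeff 2 * h.coeff 0 := by
      rw [coeff_mul]; simp [Finset.Nat.antidiagonal_succ]; ring
    rw [pow_succ, c1, c2, mul_coeff_zero, i0]
    refine ⟨by ring, ?_, ?_⟩
    · push_cast; linear_combination h.coeff 0 * i1
    · push_cast
      linear_combination h.coeff 0 * i2 + 2 * h.coeff 0 * h.coeff 1 * i1

open Polynomial in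
theorem qr_taylor_root {K : Type*} [Field K] (f : K[X]) (b : K) (hb : f.eval b = 0) :
    ∃ h : K[X], taylor b f = X * h ∧ h.coeff 0 = f.derivative.eval b ∧
      2 * h.coeff 1 = f.derivative.derivative.eval b ∧
      6 * h.coeff 2 = f.derivative.derivative.derivative.eval b := by
  have : X ∣ taylor b f := by rw [X_dvd_iff, taylor_coeff_zero, hb]
  obtain ⟨h, hh⟩ := this
  have hc : ∀ k, h.coeff k = (taylor b f).coeff (k + 1) := fun k => by rw [hh, coeff_X_mul]
  refine ⟨h, hh, ?_, ?_, ?_⟩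
  · rw [hc, taylor_coeff_one]
  · rw [hc, taylor_coeff]
    have := congrArg (eval b) (congrFun (factorial_smul_hasseDeriv (R := K) 2) f)
    simpa [Nat.factorial, nsmul_eq_mul] using this
  · rw [hc, taylor_coeff]
    have := congrArg (eval b) (congrFun (factorial_smul_hasseDeriv (R := K) 3) f)
    simpa [Nat.factorial, nsmul_eq_mul] using this

/-- Pure algebra behind the third order condition. -/
theorem qr_alg {K : Type*} [Field K] (n N c D1 D2 D3 h0 h1 h2 P1 g g1 g2 s1 s2 s3 W : K)
    (hN : 2 * N = -1) (h00 : h0 ≠ 0) (hg : g ≠ 0)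
    (t0 : c * P1 = D1 * s1) (H0 : c * P1 ≠ 0)
    (t1 : c * (n * P1 * h1) = h0 * (D2 * s2))
    (t2 : c * (P1 * (2 * n * h0 * h2 + n * (n - 1) * h1 ^ 2)) = 2 * h0 ^ 2 * (D3 * s3))
    (d2 : (n + 1) * D2 = D1 * (N - 1)) (d3 : (n + 2) * D3 = D2 * (N - 2))
    (r1 : g * s1 = 1) (r2 : g1 * s1 = g * s2) (r3 : 2 * g * s3 = 2 * g1 * s2 - g2 * s1) :
    2 * n * (n + 1) * h1 * g = -3 * h0 * g1 ∧
    (h0 * W = n * (n + 1) * (6 * g * h2 + 2 * g1 * h1) + 3 * g2 * h0 + 6 * g1 * h1 →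
      n * (n + 1) * (4 * n * (n + 1) * (n + 2) * (g * W)
        + 3 * (n - 1) * (n - 2) * (4 * n + 3) * g1 ^ 2
        + (45 * n * (n + 1) - 12 * n * (n + 1) * (n + 2)) * (g * g2)) = 0) := by
  have hs1 : s1 = 1 / g := by field_simp; linear_combination r1
  have hs2 : s2 = g1 / g ^ 2 := by
    rw [hs1] at r2; field_simp at r2 ⊢; linear_combination -r2
  have hs3 : 2 * g ^ 3 * s3 = 2 * g1 ^ 2 - g * g2 := by
    rw [hs1, hs2] at r3; field_simp at r3; linear_combination r3
  have hD1 : D1 ≠ 0 := by rintro rfl; exact H0 (by rw [t0]; ring)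
  have hD : c * P1 * g = D1 := by rw [t0, mul_assoc, mul_comm s1, r1, mul_one]
  have A1 : 2 * n * (n + 1) * h1 * g = -3 * h0 * g1 := by
    have : D1 * (2 * n * (n + 1) * h1 * g) = D1 * (-3 * h0 * g1) := by
      rw [hs2] at t1
      field_simp at t1
      rw [← hD]
      have e : c * P1 * g * (-3) = 2 * (n + 1) * D2 := by
        rw [hD]; linear_combination (-2) * d2 - D1 * hN
      linear_combination 2 * (n + 1) * t1 - h0 * g1 * e
    exact mul_left_cancel₀ hD1 this
  refine ⟨A1, fun hW => ?_⟩
  have e3 : D1 * 15 = 4 * (n + 1) * (n + 2) * D3 := by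
    linear_combination (-4) * (n + 1) * d3 - 4 * (N - 2) * d2 - D1 * (2 * N - 7) * hN
  have A2 : 4 * (n + 1) * (n + 2) * g ^ 2 * (2 * n * h0 * h2 + n * (n - 1) * h1 ^ 2)
      = 15 * h0 ^ 2 * (2 * g1 ^ 2 - g * g2) := by
    have : D1 * (4 * (n + 1) * (n + 2) * g ^ 2 * (2 * n * h0 * h2 + n * (n - 1) * h1 ^ 2))
      = D1 * (15 * h0 ^ 2 * (2 * g1 ^ 2 - g * g2)) := by
      rw [← hs3]
      linear_combination 4 * (n + 1) * (n + 2) * g ^ 3 * t2 - (4 * (n + 1) * (n + 2) * g ^ 2 * (2 * n * h0 * h2 + n * (n - 1) * h1 ^ 2)) * hD - 2 * h0 ^ 2 * g ^ 3 * s3 * e3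
    exact mul_left_cancel₀ hD1 this
  have hfin : h0 ^ 2 * (n * (n + 1) * (4 * n * (n + 1) * (n + 2) * (g * W)
        + 3 * (n - 1) * (n - 2) * (4 * n + 3) * g1 ^ 2
        + (45 * n * (n + 1) - 12 * n * (n + 1) * (n + 2)) * (g * g2))) = 0 := by
    linear_combination n * (n + 1) * (4 * n * (n + 1) * (n + 2)) * g * h0 * hW
      + 3 * n ^ 2 * (n + 1) ^ 2 * A2
      + (-3 * n * (n + 1) * (n + 2) * (n - 1) * (2 * n * (n + 1) * h1 * g - 3 * h0 * g1)) * A1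
      + 2 * n * (n + 1) * (n + 2) * (2 * n * (n + 1) + 6) * g1 * h0 * A1
  exact (mul_eq_zero.1 hfin).resolve_left (pow_ne_zero _ h00)

open Polynomial in
theorem qr_local {p : ℕ} [Fact p.Prime] (A B : Finset (ZMod p)) (hA : 1 ≤ A.card)
    (N : ℕ) (hN : 3 ≤ N) (hpN : p = 2 * N + 1) (hp : N + (A.card - 1) < p)
    (h : ∀ a ∈ A, ∀ b ∈ B, (b - a) ^ N = 1) (hcard : A.card * B.card = N)
    (b : ZMod p) (hb : b ∈ B) (f g : (ZMod p)[X]) (hf : f = Lagrange.nodal B id)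
    (hg : g = Lagrange.nodal A id) (n : ZMod p) (hn : n = A.card) :
    (derivative f).eval b ≠ 0 ∧
    n * (n + 1) * (g.eval b * (derivative (derivative f)).eval b)
      + 3 * ((derivative g).eval b * (derivative f).eval b) = 0 ∧
    ∀ W : ZMod p, (derivative f).eval b * W =
      n * (n + 1) * (g.eval b * (derivative (derivative (derivative f))).eval b
        + (derivative g).eval b * (derivative (derivative f)).eval b)
      + 3 * ((derivative (derivative g)).eval b * (derivative f).eval b
        + (derivative g).eval b * (derivative (derivative f)).eval b) →
      n * (n + 1) * (4 * n * (n + 1) * (n + 2) * (g.eval b * W)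
        + 3 * (n - 1) * (n - 2) * (4 * n + 3) * (derivative g).eval b ^ 2
        + (45 * n * (n + 1) - 12 * n * (n + 1) * (n + 2))
          * (g.eval b * (derivative (derivative g)).eval b)) = 0 := by
  obtain ⟨c, hc, hF⟩ := (qr_HP A B hA N (by omega) hp h).2 hcard
  have hfb : f.eval b = 0 := by rw [hf]; exact Lagrange.eval_nodal_at_node (v := id) hb
  obtain ⟨q, hq, q0, q1, q2⟩ := qr_taylor_root f b hfb
  have hne : ∀ a ∈ A, b ≠ a := by
    intro a ha hba
    have := h a ha b hb
    rw [hba, sub_self, zero_pow (by omega)] at this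
    exact zero_ne_one this
  have hgb : g.eval b ≠ 0 := by
    rw [hg]; exact Lagrange.eval_nodal_not_at_node (v := id) hne
  have hf' : (derivative f).eval b ≠ 0 := by
    have := Lagrange.eval_nodal_derivative_eval_node_eq (v := (id : ZMod p → ZMod p)) hb
    rw [hf]; simp only [id] at this; rw [this]
    apply Lagrange.eval_nodal_not_at_node (v := id)
    intro a ha; exact (Finset.ne_of_mem_erase ha).symm
  have key : ∀ j, c * (q ^ A.card).coeff j =
      (∑ a ∈ A, Lagrange.nodalWeight A id a * (b - a) ^ (N + (A.card - 1) - (A.card + j))) *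
        ((N + (A.card - 1)).choose (A.card + j) : ZMod p) := by
    intro j
    have := qrF_taylor A N b (A.card + j)
    rw [if_neg (by omega), sub_zero] at this
    rw [← this, hF, taylor_mul, taylor_pow, ← hf, hq, taylor_C, coeff_C_mul, mul_pow, add_comm,
      coeff_X_pow_mul]
  have inv : ∀ j, 1 ≤ j → j ≤ 3 → 
      ∑ a ∈ A, Lagrange.nodalWeight A id a * (b - a) ^ (N - j)
      = ∑ a ∈ A, Lagrange.nodalWeight A id a * ((b - a)⁻¹) ^ j := by
    intro j hj hj3
    refine Finset.sum_congr rfl fun a ha => ?_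
    congr 1
    have h1 := h a ha b hb
    have h0 := sub_ne_zero.2 (hne a ha)
    rw [show N = (N - j) + j by omega, pow_add] at h1
    rw [inv_pow]; exact eq_inv_of_mul_eq_one_left h1
  have k0 := key 0
  have k1 := key 1
  have k2 := key 2
  rw [show N + (A.card - 1) - (A.card + 0) = N - 1 by omega, inv 1 (by omega) (by omega)] at k0
  rw [show N + (A.card - 1) - (A.card + 1) = N - 2 by omega, inv 2 (by omega) (by omega)] at k1
  rw [show N + (A.card - 1) - (A.card + 2) = N - 3 by omega, inv 3 (by omega) (by omega)] at k2
  simp only [pow_one] at k0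
  obtain ⟨c0, c1, c2⟩ := qr_coeff_pow q A.card
  obtain ⟨r1, r2, r3⟩ := qr_sigma A (Finset.card_pos.1 hA) b hne
  rw [← hg] at r1 r2 r3
  have hNK : (2 : ZMod p) * (N : ZMod p) = -1 := by
    have : ((2 * N + 1 : ℕ) : ZMod p) = 0 := by rw [← hpN]; simp
    push_cast at this
    linear_combination this
  have d2 : (n + 1) * ((N + (A.card - 1)).choose (A.card + 1) : ZMod p)
      = ((N + (A.card - 1)).choose (A.card + 0) : ZMod p) * ((N : ZMod p) - 1) := by
    have := congrArg (Nat.cast (R := ZMod p)) (Nat.choose_succ_right_eq (N + (A.card - 1)) A.card)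
    rw [show N + (A.card - 1) - A.card = N - 1 by omega] at this
    push_cast [Nat.cast_sub (show 1 ≤ N by omega)] at this
    rw [hn, add_zero, ← this]; ring
  have d3 : (n + 2) * ((N + (A.card - 1)).choose (A.card + 2) : ZMod p)
      = ((N + (A.card - 1)).choose (A.card + 1) : ZMod p) * ((N : ZMod p) - 2) := by
    have := congrArg (Nat.cast (R := ZMod p)) (Nat.choose_succ_right_eq (N + (A.card - 1)) (A.card + 1))
    rw [show N + (A.card - 1) - (A.card + 1) = N - 2 by omega] at this
    push_cast [Nat.cast_sub (show 2 ≤ N by omega)] at this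
    rw [hn, ← this]; ring
  have hq0 : q.coeff 0 ≠ 0 := by rw [q0]; exact hf'
  rw [← hn] at c1 c2
  have main := fun W => qr_alg n (N : ZMod p) c _ _ _ (q.coeff 0) (q.coeff 1) (q.coeff 2)
    (q.coeff 0 ^ A.card) (g.eval b) ((derivative g).eval b) ((derivative (derivative g)).eval b)
    _ _ _ W hNK hq0 hgb (by rw [← c0, k0]; ring)
    (mul_ne_zero hc (pow_ne_zero _ hq0))
    (by rw [← c1]; linear_combination q.coeff 0 * k1)
    (by rw [← c2]; linear_combination 2 * q.coeff 0 ^ 2 * k2) d2 d3 r1 r2 r3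
  refine ⟨hf', ?_, ?_⟩
  · have := (main 0).1
    rw [← q0, ← q1]; linear_combination this
  · intro W hW
    apply (main W).2
    rw [← q0, ← q1, ← q2] at hW
    rw [hW]; ring

open Polynomial in
theorem qr_main {p : ℕ} [Fact p.Prime] (A B : Finset (ZMod p)) (hA : 3 ≤ A.card)
    (N : ℕ) (hN : 3 ≤ N) (hpN : p = 2 * N + 1)
    (h : ∀ a ∈ A, ∀ b ∈ B, (b - a) ^ N = 1) (hcard : A.card * B.card = N)
    (hAB : A.card ≤ B.card) : B.card ≤ 2 * A.card - 2 := by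
  by_contra hcon
  set f := Lagrange.nodal B (id : ZMod p → ZMod p) with hf
  set g := Lagrange.nodal A (id : ZMod p → ZMod p) with hg
  set n : ZMod p := (A.card : ZMod p) with hn
  have hbig : 3 * A.card ≤ N := by nlinarith
  have hbig2 : 4 * A.card + 3 < p := by nlinarith
  have loc := fun b hb => qr_local A B (by omega) N hN hpN (by omega) h hcard b hb f g hf hg n hn
  have fdeg : f.natDegree = B.card := Lagrange.natDegree_nodal
  have gdeg : g.natDegree = A.card := Lagrange.natDegree_nodal
  have f1 : (derivative f).natDegree ≤ B.card - 1 := by rw [← fdeg]; exact natDegree_derivative_le f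
  have f2 : (derivative (derivative f)).natDegree ≤ B.card - 2 := by
    have := natDegree_derivative_le (derivative f); omega
  have g1 : (derivative g).natDegree ≤ A.card - 1 := by rw [← gdeg]; exact natDegree_derivative_le g
  have g2 : (derivative (derivative g)).natDegree ≤ A.card - 2 := by
    have := natDegree_derivative_le (derivative g); omega
  set Q := C (n * (n + 1)) * (g * derivative (derivative f)) + C 3 * (derivative g * derivative f) with hQ
  have hfQ : f ∣ Q := by
    rw [hf, Lagrange.nodal]
    apply Finset.prod_dvd_of_coprime
    · intro b _ b' _ hbb
      exact pairwise_coprime_X_sub_C Function.injective_id hbb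
    · intro b hb
      rw [id, dvd_iff_isRoot, IsRoot, hQ]
      simpa using (loc b hb).2.1
  obtain ⟨W, hW⟩ := hfQ
  have hQdeg : Q.natDegree ≤ A.card + B.card - 2 := by
    rw [hQ]
    refine (natDegree_add_le _ _).trans (max_le ?_ ?_)
    · refine (natDegree_C_mul_le _ _).trans (natDegree_mul_le.trans ?_); omega
    · refine (natDegree_C_mul_le _ _).trans (natDegree_mul_le.trans ?_); omega
  have hWdeg : W.natDegree ≤ A.card - 2 := by
    by_cases hW0 : W = 0
    · rw [hW0]; simp
    · have := natDegree_mul (p := f) (q := W) Lagrange.nodal_ne_zero hW0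
      rw [← hW, fdeg] at this; omega
  set E := C (4 * n * (n + 1) * (n + 2)) * (g * W)
    + C (3 * (n - 1) * (n - 2) * (4 * n + 3)) * (derivative g) ^ 2
    + C (45 * n * (n + 1) - 12 * n * (n + 1) * (n + 2)) * (g * derivative (derivative g)) with hE
  have nz : ∀ k : ℕ, 0 < k → k < p → (k : ZMod p) ≠ 0 := by
    intro k hk hkp
    rw [Ne, ZMod.natCast_eq_zero_iff]
    exact fun hd => absurd (Nat.le_of_dvd hk hd) (by omega)
  have n0 : n ≠ 0 := nz _ (by omega) (by omega)
  have n1 : n + 1 ≠ 0 := by simpa using nz (A.card + 1) (by omega) (by omega)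
  have hEb : ∀ b ∈ B, E.eval b = 0 := by
    intro b hb
    have hd := congrArg (fun r => eval b (derivative r)) hW
    have hfb : f.eval b = 0 := Lagrange.eval_nodal_at_node (v := id) hb
    rw [hQ] at hd
    simp only [derivative_add, derivative_mul, derivative_C, eval_add, eval_mul, eval_C, hfb,
      zero_mul, zero_add, add_zero] at hd
    have := (loc b hb).2.2 (W.eval b) (by rw [← hd]; ring)
    have := (mul_eq_zero.1 this).resolve_left (mul_ne_zero n0 n1)
    rw [hE]; simpa using this
  have hEdeg : E.natDegree ≤ 2 * A.card - 2 := by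
    rw [hE]
    refine (natDegree_add_le _ _).trans (max_le ((natDegree_add_le _ _).trans (max_le ?_ ?_)) ?_)
    · refine (natDegree_C_mul_le _ _).trans (natDegree_mul_le.trans ?_); omega
    · refine (natDegree_C_mul_le _ _).trans (natDegree_pow_le.trans ?_); omega
    · refine (natDegree_C_mul_le _ _).trans (natDegree_mul_le.trans ?_); omega
  have hE0 : E = 0 := by
    apply eq_zero_of_degree_lt_of_eval_finset_eq_zero B _ hEb
    refine lt_of_le_of_lt degree_le_natDegree ?_
    exact_mod_cast (by omega)
  obtain ⟨a, ha⟩ : A.Nonempty := Finset.card_pos.1 (by omega)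
  have hga : g.eval a = 0 := Lagrange.eval_nodal_at_node (v := id) ha
  have hg'a : (derivative g).eval a ≠ 0 := by
    have := Lagrange.eval_nodal_derivative_eval_node_eq (v := (id : ZMod p → ZMod p)) ha
    rw [hg]; simp only [id] at this; rw [this]
    apply Lagrange.eval_nodal_not_at_node (v := id)
    intro a ha; exact (Finset.ne_of_mem_erase ha).symm
  have := congrArg (eval a) hE0
  rw [hE] at this
  simp only [eval_add, eval_mul, eval_C, hga, zero_mul, mul_zero, zero_add, add_zero, eval_pow,
    eval_zero] at this
  have m1 : n - 1 ≠ 0 := by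
    have := nz (A.card - 1) (by omega) (by omega)
    rwa [Nat.cast_sub (by omega), Nat.cast_one] at this
  have m2 : n - 2 ≠ 0 := by
    have := nz (A.card - 2) (by omega) (by omega)
    rwa [Nat.cast_sub (by omega), Nat.cast_two] at this
  have m3 : 4 * n + 3 ≠ 0 := by
    have := nz (4 * A.card + 3) (by omega) (by omega)
    simpa using this
  have m4 : (3 : ZMod p) ≠ 0 := by
    simpa using nz 3 (by omega) (by omega)
  exact mul_ne_zero (mul_ne_zero (mul_ne_zero (mul_ne_zero m4 m1) m2) m3) (pow_ne_zero _ hg'a) this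

def qrb19 (z : ZMod 19) : Bool :=
  Nat.testBit 199410 (ZMod.val z)

theorem qrb19_iff : ∀ z : ZMod 19, qrb19 z = true ↔ z ≠ 0 ∧ IsSquare z := by
  decide

def qrt19 (x y z : ZMod 19) : Bool := qrb19 z && qrb19 (z + x) && qrb19 (z + y)

theorem qr_check19 : ∀ x y : ZMod 19, x ≠ 0 → y ≠ 0 → x ≠ y →
    ∃ r : ZMod 19, (qrb19 r && !(qrt19 x y r) && !(qrt19 x y (r - x)) && !(qrt19 x y (r - y))) = true := by
  decide +kernel

def qrm41 (y : ℕ) : Bool :=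
  Nat.testBit 1870503675702 (y % 41)

theorem qrm41_of : ∀ r : ZMod 41, r * r ≠ 0 → qrm41 (r * r).val = true := by
  decide +kernel

def qrL1 (x : ℕ) : List ℕ := (List.range 41).filter fun y => qrm41 y && qrm41 (y + x)

theorem qr_check41 : ((List.range 41).all fun x => x == 0 || (List.range 41).all fun y =>
    y == 0 || y == x || decide (((qrL1 x).filter fun z => qrm41 (z + y)).length < 5) ||
      (List.range 41).all fun w => w == 0 || w == x || w == y ||
        decide ((((qrL1 x).filter fun z => qrm41 (z + y)).filter
          fun z => qrm41 (z + w)).length < 5)) = true := by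
  decide +kernel

theorem qr_mem (p : ℕ) [Fact p.Prime] (x : ZMod p) : x ∈ Rp p ↔ x ≠ 0 ∧ IsSquare x := by
  simp [Rp]

theorem qr_mem_pow (p : ℕ) [Fact p.Prime] (N : ℕ) (hpN : p = 2 * N + 1) (x : ZMod p) (hx : x ∈ Rp p) :
    x ^ N = 1 := by
  rw [qr_mem] at hx
  have := (ZMod.euler_criterion p hx.1).1 hx.2
  rwa [show p / 2 = N by omega] at this

theorem qr_card (p : ℕ) [Fact p.Prime] (N : ℕ) (hpN : p = 2 * N + 1) : N ≤ (Rp p).card := by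
  have h := Finset.card_le_mul_card_image (f := fun x : ZMod p => x * x) (Finset.univ.erase (0 : ZMod p)) 2 (by
    intro a ha
    obtain ⟨x0, _, rfl⟩ := Finset.mem_image.1 ha
    refine (Finset.card_le_card (t := {x0, -x0}) ?_).trans Finset.card_le_two
    intro y hy
    have := (Finset.mem_filter.1 hy).2
    simpa using mul_self_eq_mul_self_iff.1 this)
  rw [Finset.card_erase_of_mem (Finset.mem_univ _), Finset.card_univ, ZMod.card] at h
  have h2 : (Finset.image (fun x : ZMod p => x * x) (Finset.univ.erase (0 : ZMod p))) ⊆ Rp p := by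
    intro y hy
    obtain ⟨x, hx, rfl⟩ := Finset.mem_image.1 hy
    rw [qr_mem]
    have := Finset.ne_of_mem_erase hx
    exact ⟨mul_self_ne_zero.2 this, x, rfl⟩
  have := Finset.card_le_card h2
  omega

/-- The bound for sums. -/
theorem qr_bound (p : ℕ) [Fact p.Prime] (N : ℕ) (hpN : p = 2 * N + 1) (A B : Finset (ZMod p))
    (hA : 1 ≤ A.card) (hAN : A.card ≤ N)
    (h : ∀ a ∈ A, ∀ b ∈ B, a + b ∈ Rp p) : A.card * B.card ≤ N := by
  have := (qr_HP (-A) B (by simpa using hA) N (by omega) (by rw [Finset.card_neg]; omega) (by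
    intro a ha b hb
    have := h (-a) (by simpa using ha) b hb
    rw [show b - a = -a + b by ring]
    exact qr_mem_pow p N hpN _ this)).1
  simpa using this

theorem qr_large (p : ℕ) [Fact p.Prime] (N : ℕ) (hpN : p = 2 * N + 1) (A B : Finset (ZMod p))
    (hA : 3 ≤ A.card) (hAB : A.card ≤ B.card) (hAN : A.card * B.card = N)
    (h : ∀ a ∈ A, ∀ b ∈ B, a + b ∈ Rp p) : B.card ≤ 2 * A.card - 2 := by
  have := qr_main (-A) B (by simpa using hA) N (by nlinarith) hpN (by
    intro a ha b hb
    have := h (-a) (by simpa using ha) b hb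
    rw [show b - a = -a + b by ring]
    exact qr_mem_pow p N hpN _ this) (by simpa using hAN) (by simpa using hAB)
  simpa using this

theorem qr_case19 (A B : Finset (ZMod 19)) [Fact (Nat.Prime 19)] (hA : A.card = 3)
    (h : A + B = Rp 19) : False := by
  obtain ⟨a, b, c, hab, hac, hbc, rfl⟩ := Finset.card_eq_three.1 hA
  obtain ⟨r, hr⟩ := qr_check19 (b - a) (c - a) (sub_ne_zero.2 hab.symm) (sub_ne_zero.2 hac.symm)
    (fun e => hbc (by linear_combination e))
  simp only [Bool.and_eq_true, Bool.not_eq_true'] at hr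
  obtain ⟨⟨⟨h0, h1⟩, h2⟩, h3⟩ := hr
  have hmem : ∀ z : ZMod 19, qrb19 z = true ↔ z ∈ Rp 19 := fun z => by rw [qrb19_iff, qr_mem]
  have hB : ∀ y ∈ B, qrt19 (b - a) (c - a) (a + y) = true := by
    intro y hy
    simp only [qrt19, Bool.and_eq_true, hmem, ← h]
    refine ⟨⟨Finset.add_mem_add (by simp) hy, ?_⟩, ?_⟩
    · rw [show a + y + (b - a) = b + y by ring]; exact Finset.add_mem_add (by simp) hy
    · rw [show a + y + (c - a) = c + y by ring]; exact Finset.add_mem_add (by simp) hy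
  rw [hmem, ← h] at h0
  obtain ⟨x, hx, y, hy, rfl⟩ := Finset.mem_add.1 h0
  have := hB y hy
  simp only [Finset.mem_insert, Finset.mem_singleton] at hx
  rcases hx with rfl | rfl | rfl
  · rw [this] at h1; exact absurd h1 (by simp)
  · rw [show x + y - (x - a) = a + y by ring, this] at h2; exact absurd h2 (by simp)
  · rw [show x + y - (x - a) = a + y by ring, this] at h3; exact absurd h3 (by simp)

theorem qr_case41 (A B : Finset (ZMod 41)) [Fact (Nat.Prime 41)] (hA : A.card = 4) (hB : B.card = 5)
    (h : A + B = Rp 41) : False := by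
  obtain ⟨a, A', haA, rfl, hA'⟩ := Finset.card_eq_succ.1 hA
  obtain ⟨b, c, d, hbc, hbd, hcd, rfl⟩ := Finset.card_eq_three.1 hA'
  simp only [Finset.mem_insert, Finset.mem_singleton, not_or] at haA
  obtain ⟨hab, hac, had⟩ := haA
  have hmem : ∀ z : ZMod 41, z ∈ Rp 41 → qrm41 z.val = true := by
    intro z hz
    rw [qr_mem] at hz
    obtain ⟨hz0, r, rfl⟩ := hz
    exact qrm41_of r hz0
  have hm : ∀ z w : ZMod 41, z + w ∈ Rp 41 → qrm41 (z.val + w.val) = true := by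
    intro z w hz
    have := hmem _ hz
    rw [ZMod.val_add] at this
    simpa [qrm41, Nat.mod_mod] using this
  have hin : ∀ y ∈ B, (a + y) ∈ Rp 41 ∧ (a + y) + (b - a) ∈ Rp 41 ∧ (a + y) + (c - a) ∈ Rp 41
      ∧ (a + y) + (d - a) ∈ Rp 41 := by
    intro y hy
    rw [← h, show a + y + (b - a) = b + y by ring, show a + y + (c - a) = c + y by ring,
      show a + y + (d - a) = d + y by ring]
    refine ⟨?_, ?_, ?_, ?_⟩ <;> exact Finset.add_mem_add (by simp) hy
  have L2 : ∀ y ∈ B, (a + y).val ∈ (qrL1 (b - a).val).filter fun z => qrm41 (z + (c - a).val) := by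
    intro y hy
    obtain ⟨i0, i1, i2, i3⟩ := hin y hy
    rw [List.mem_filter, qrL1, List.mem_filter, List.mem_range, Bool.and_eq_true]
    exact ⟨⟨ZMod.val_lt _, hmem _ i0, hm _ _ i1⟩, hm _ _ i2⟩
  have L3 : ∀ y ∈ B, (a + y).val ∈ ((qrL1 (b - a).val).filter
      fun z => qrm41 (z + (c - a).val)).filter fun z => qrm41 (z + (d - a).val) := by
    intro y hy
    rw [List.mem_filter]
    exact ⟨L2 y hy, hm _ _ (hin y hy).2.2.2⟩
  have hlen : ∀ l : List ℕ, (∀ y ∈ B, (a + y).val ∈ l) → 5 ≤ l.length := by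
    intro l hl
    have h1 : (B.image fun y => (a + y).val) ⊆ l.toFinset := by
      intro z hz
      obtain ⟨y, hy, rfl⟩ := Finset.mem_image.1 hz
      rw [List.mem_toFinset]; exact hl y hy
    have h2 := Finset.card_le_card h1
    rw [Finset.card_image_of_injective, hB] at h2
    · exact h2.trans (List.toFinset_card_le l)
    · intro y y' hyy
      exact add_left_cancel (ZMod.val_injective 41 hyy)
  have n2 := hlen _ L2
  have n3 := hlen _ L3
  have vne : ∀ z w : ZMod 41, z ≠ w → z.val ≠ w.val := fun z w hzw e => hzw (ZMod.val_injective 41 e)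
  have v0 : ∀ z : ZMod 41, z ≠ a → (z - a).val ≠ 0 := by
    intro z hz e
    exact hz (sub_eq_zero.1 ((ZMod.val_eq_zero _).1 e))
  have v1 : ∀ z w : ZMod 41, z ≠ w → (z - a).val ≠ (w - a).val := by
    intro z w hzw e
    exact hzw (by have := ZMod.val_injective 41 e; linear_combination this)
  have ck := qr_check41
  rw [List.all_eq_true] at ck
  have ck1 := ck (b - a).val (List.mem_range.2 (ZMod.val_lt _))
  rw [Bool.or_eq_true, beq_iff_eq, List.all_eq_true] at ck1
  have ck2 := (ck1.resolve_left (v0 b (Ne.symm hab))) (c - a).val (List.mem_range.2 (ZMod.val_lt _))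
  rw [Bool.or_eq_true, Bool.or_eq_true, Bool.or_eq_true, beq_iff_eq, beq_iff_eq, decide_eq_true_iff,
    List.all_eq_true] at ck2
  have ck3 := (ck2.resolve_left (by
    rintro ((h | h) | h)
    · exact v0 c (Ne.symm hac) h
    · exact v1 c b (Ne.symm hbc) h
    · omega)) (d - a).val (List.mem_range.2 (ZMod.val_lt _))
  rw [Bool.or_eq_true, Bool.or_eq_true, Bool.or_eq_true, beq_iff_eq, beq_iff_eq, beq_iff_eq,
    decide_eq_true_iff] at ck3
  rcases ck3 with ((h | h) | h) | h
  · exact v0 d (Ne.symm had) h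
  · exact v1 d b (Ne.symm hbd) h
  · exact v1 d c (Ne.symm hcd) h
  · omega

theorem qr_two_nat (p : ℕ) (hp : 13 ≤ p) (E : ℕ → ℤ) (t : ℤ) (ht : t = 1 ∨ t = -1)
    (e0 : E 0 = 0) (e1 : E 1 = 1)
    (pm : ∀ k, 0 < k → k < p → E k = 1 ∨ E k = -1)
    (mul : ∀ i j, E (i * j) = E i * E j) (v : ℕ) (hv0 : 0 < v) (hvp : v < p) (hv : E v = t)
    (iso : ∀ k, t * E (k + 1) = 1 → t * E (k + 2) = 1 ∨ t * E k = 1)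
    (no3 : ∀ k, t * E k = 1 → t * E (k + 1) = 1 → t * E (k + 2) = 1 → False) : False := by
  have e4 : E 4 = E 2 * E 2 := mul 2 2
  have e6 : E 6 = E 2 * E 3 := mul 2 3
  have e8 : E 8 = E 2 * E 4 := mul 2 4
  have e9 : E 9 = E 3 * E 3 := mul 3 3
  have e10 : E 10 = E 2 * E 5 := mul 2 5
  have e12 : E 12 = E 3 * E 4 := mul 3 4
  have p2 := pm 2 (by omega) (by omega)
  have p3 := pm 3 (by omega) (by omega)
  have p5 := pm 5 (by omega) (by omega)
  rcases ht with rfl | rfl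
  · -- d is a residue
    have i0 := iso 0
    have n1 := no3 1
    have i3 := iso 3
    have n8 := no3 8
    norm_num only [one_mul] at i0 n1 i3 n8
    have k2 : E 2 = 1 := by
      have := i0 e1; omega
    have k3 : E 3 = -1 := p3.resolve_left (n1 e1 k2)
    rw [k2] at e4 e8 e10
    rw [k3] at e9 i3
    have k4 : E 4 = 1 := by omega
    have k5 : E 5 = 1 := by have := i3 k4; omega
    exact n8 (by omega) (by omega) (by omega)
  · have tr : ∀ z : ℤ, (-1 : ℤ) * z = 1 ↔ z = -1 := by intro z; omega
    simp only [tr] at iso no3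
    rcases p2 with k2 | k2
    · -- 2 is a residue
      have all : ∀ k : ℕ, 0 < k → k < p → E k = 1 := by
        intro k
        induction k using Nat.strong_induction_on with
        | _ k ih =>
          intro hk hkp
          rcases Nat.even_or_odd' k with ⟨t, rfl | rfl⟩
          · rw [mul, k2, ih t (by omega) (by omega) (by omega)]; norm_num
          · rcases Nat.eq_zero_or_pos t with rfl | ht
            · exact e1
            · rcases pm (2 * t + 1) hk hkp with h | h
              · exact h
              · exfalso
                rcases iso (2 * t) h with h' | h'
                · rw [show 2 * t + 2 = 2 * (t + 1) by ring, mul, k2,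
                    ih (t + 1) (by omega) (by omega) (by omega)] at h'
                  norm_num at h'
                · rw [ih (2 * t) (by omega) (by omega) (by omega)] at h'
                  norm_num at h'
      have := all v hv0 hvp
      omega
    · have i1 := iso 1 k2
      have i4 := iso 4
      have i9 := iso 9
      have n10 := no3 10
      norm_num only at i1 i4 i9 n10
      rw [k2] at e4 e6 e10
      have k3 : E 3 = -1 := by omega
      rw [k3] at e6 e9 e12
      have k4 : E 4 = 1 := by omega
      have k5 : E 5 = 1 := by omega
      exact n10 (by omega) (by omega) (by omega)

/-- Combinatorial contradiction for `|A| = 2`. -/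
theorem qr_two_comb (p : ℕ) [Fact p.Prime] (hp : 13 ≤ p) (d : ZMod p) (hd : d ≠ 0)
    (iso : ∀ x : ZMod p, d * x ∈ Rp p → d * (x + 1) ∈ Rp p ∨ d * (x - 1) ∈ Rp p)
    (no3 : ∀ x : ZMod p, d * x ∈ Rp p → d * (x + 1) ∈ Rp p → d * (x + 2) ∈ Rp p → False) : False := by
  set χ := quadraticChar (ZMod p) with hχ
  have mem : ∀ x : ZMod p, x ∈ Rp p ↔ χ x = 1 := by
    intro x
    rw [qr_mem]
    constructor
    · rintro ⟨h0, h1⟩; exact (quadraticChar_one_iff_isSquare h0).2 h1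
    · intro hx
      have h0 : x ≠ 0 := by rintro rfl; simp [hχ] at hx
      exact ⟨h0, (quadraticChar_one_iff_isSquare h0).1 hx⟩
  simp only [mem, map_mul] at iso no3
  have nz : ∀ k : ℕ, 0 < k → k < p → (k : ZMod p) ≠ 0 := by
    intro k hk hkp
    rw [Ne, ZMod.natCast_eq_zero_iff]
    exact fun hd => absurd (Nat.le_of_dvd hk hd) (by omega)
  have pm : ∀ k : ℕ, 0 < k → k < p → χ (k : ZMod p) = 1 ∨ χ (k : ZMod p) = -1 :=
    fun k hk hkp => quadraticChar_dichotomy (nz k hk hkp)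
  have mul : ∀ i j : ℕ, χ ((i * j : ℕ) : ZMod p) = χ (i : ZMod p) * χ (j : ZMod p) := by
    intro i j; push_cast; exact map_mul χ _ _
  have e0 : χ ((0 : ℕ) : ZMod p) = 0 := by simp [hχ]
  have e1 : χ ((1 : ℕ) : ZMod p) = 1 := by simp
  have iso' : ∀ k : ℕ, χ d * χ ((k + 1 : ℕ) : ZMod p) = 1 →
      χ d * χ ((k + 2 : ℕ) : ZMod p) = 1 ∨ χ d * χ (k : ZMod p) = 1 := by
    intro k hk
    have := iso _ hk
    rwa [show ((k + 1 : ℕ) : ZMod p) + 1 = ((k + 2 : ℕ) : ZMod p) by push_cast; ring,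
      show ((k + 1 : ℕ) : ZMod p) - 1 = (k : ZMod p) by push_cast; ring] at this
  have no3' : ∀ k : ℕ, χ d * χ (k : ZMod p) = 1 → χ d * χ ((k + 1 : ℕ) : ZMod p) = 1 →
      χ d * χ ((k + 2 : ℕ) : ZMod p) = 1 → False := by
    intro k h0 h1 h2
    apply no3 _ h0
    · exact_mod_cast h1
    · exact_mod_cast h2
  have hdv : χ ((d.val : ℕ) : ZMod p) = χ d := by rw [ZMod.natCast_zmod_val]
  have hdpos : 0 < d.val := Nat.pos_of_ne_zero (by rwa [Ne, ZMod.val_eq_zero])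
  exact qr_two_nat p hp (fun k => χ (k : ZMod p)) (χ d) (quadraticChar_dichotomy hd) e0 e1 pm mul
    d.val hdpos (ZMod.val_lt _) hdv iso' no3'

theorem qr_two (p : ℕ) [Fact p.Prime] (N : ℕ) (hpN : p = 2 * N + 1) (A B : Finset (ZMod p))
    (hA : A.card = 2) (hAB : A.card ≤ B.card) (hAN : A.card * B.card = N) (hR : (Rp p).card = N)
    (h : A + B = Rp p) : False := by
  have hmax : ∀ x : ZMod p, (∀ a ∈ A, a + x ∈ Rp p) → x ∈ B := by
    intro x hx
    by_contra hxB
    have := qr_bound p N hpN A (insert x B) (by omega) (by nlinarith) (by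
      intro a ha b hb
      rcases Finset.mem_insert.1 hb with rfl | hb
      · exact hx a ha
      · rw [← h]; exact Finset.add_mem_add ha hb)
    rw [Finset.card_insert_of_notMem hxB] at this
    nlinarith
  have hinj : Set.InjOn (fun x : ZMod p × ZMod p => x.1 + x.2) ((A : Set (ZMod p)) ×ˢ (B : Set (ZMod p))) := by
    apply Finset.card_add_iff.1
    rw [h, hR, hAN]
  obtain ⟨a, c, hac, rfl⟩ := Finset.card_eq_two.1 hA
  have hd : c - a ≠ 0 := sub_ne_zero.2 hac.symm
  have hB3 : 13 ≤ p := by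
    rw [hA] at hAB hAN
    by_contra hlt
    have : B.card = 2 := by omega
    have : p = 9 := by omega
    have hp : p.Prime := Fact.out
    rw [this] at hp
    norm_num at hp
  apply qr_two_comb p hB3 (c - a) hd
  · intro x hx
    rw [← h] at hx
    obtain ⟨y, hy, b, hb, hyb⟩ := Finset.mem_add.1 hx
    simp only [Finset.mem_insert, Finset.mem_singleton] at hy
    rcases hy with rfl | rfl
    · left
      rw [show (c - y) * (x + 1) = c + b by linear_combination -hyb, ← h]
      exact Finset.add_mem_add (by simp) hb
    · right
      rw [show (y - a) * (x - 1) = a + b by linear_combination -hyb, ← h]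
      exact Finset.add_mem_add (by simp) hb
  · intro x h0 h1 h2
    have m1 : (c - a) * x - a ∈ B := by
      apply hmax
      intro y hy
      simp only [Finset.mem_insert, Finset.mem_singleton] at hy
      rcases hy with rfl | rfl
      · convert h0 using 1; ring
      · convert h1 using 1; ring
    have m2 : (c - a) * (x + 1) - a ∈ B := by
      apply hmax
      intro y hy
      simp only [Finset.mem_insert, Finset.mem_singleton] at hy
      rcases hy with rfl | rfl
      · convert h1 using 1; ring
      · convert h2 using 1; ring
    have := @hinj (c, (c - a) * x - a) ⟨by simp, by simpa using m1⟩ (a, (c - a) * (x + 1) - a)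
      ⟨by simp, by simpa using m2⟩ (by simp only; ring)
    exact hac (congrArg Prod.fst this).symm

theorem stmt_12 (p : ℕ) [Fact p.Prime] (hp : p ≠ 2) (A B : Finset (ZMod p))
    (hA : 2 ≤ A.card) (hAB : A.card ≤ B.card) (h : A + B = Rp p) :
    5 ≤ A.card := by
  by_contra hlt
  have hpp : p.Prime := Fact.out
  obtain ⟨N, hN⟩ := hpp.odd_of_ne_two hp
  have hmem : ∀ a ∈ A, ∀ b ∈ B, a + b ∈ Rp p := fun a ha b hb => by
    rw [← h]; exact Finset.add_mem_add ha hb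
  have hR := qr_card p N hN
  have hle : (Rp p).card ≤ A.card * B.card := by rw [← h]; exact Finset.card_add_le
  have hAN : A.card ≤ N := by
    obtain ⟨b, hb⟩ : B.Nonempty := Finset.card_pos.1 (by omega)
    have h1 : A.card ≤ (Rp p).card := by
      rw [← h]; exact Finset.card_le_card_add_right ⟨b, hb⟩
    have h2 := qr_bound p N hN {0} (Rp p) (by simp) (by
      have := hpp.two_le
      rw [Finset.card_singleton]; omega) (by
      intro a ha b hb
      rw [Finset.mem_singleton.1 ha, zero_add]; exact hb)
    rw [Finset.card_singleton, one_mul] at h2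
    omega
  have hb := qr_bound p N hN A B (by omega) hAN hmem
  have hAN' : A.card * B.card = N := by omega
  have hR' : (Rp p).card = N := by omega
  obtain h2 | h3 | h4 : A.card = 2 ∨ A.card = 3 ∨ A.card = 4 := by omega
  · exact qr_two p N hN A B h2 hAB hAN' hR' h
  · have := qr_large p N hN A B (by omega) hAB hAN' hmem
    rw [h3] at this hAB hAN'
    obtain h5 | h5 : B.card = 3 ∨ B.card = 4 := by omega
    · have : p = 19 := by omega
      subst this
      exact qr_case19 A B h3 h
    · have : p = 25 := by omega
      rw [this] at hpp; norm_num at hpp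
  · have := qr_large p N hN A B (by omega) hAB hAN' hmem
    rw [h4] at this hAB hAN'
    obtain h5 | h5 | h5 : B.card = 4 ∨ B.card = 5 ∨ B.card = 6 := by omega
    · have : p = 33 := by omega
      rw [this] at hpp; norm_num at hpp
    · have : p = 41 := by omega
      subst this
      exact qr_case41 A B h4 h5 h
    · have : p = 49 := by omega
      rw [this] at hpp; norm_num at hpp
end

section
/- Let p be an odd prime and suppose A, B ⊆ 𝔽_p satisfy A + B = R_p with |B| ≥ |A| ≥ 2 and |A| = δ|B| for some real δ ∈ (1/8, 1]. Then √(δ(p−1)/2) ≤ |A| ≤ min{2δ, √δ}·√(p−1) and √((p−1)/(2δ)) ≤ |B| ≤ min{2, 1/√δ}·√(p−1). -/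
open scoped Pointwise

/-- Hanson-Petridis bound via the Stepanov method. -/
theorem hanson_petridis {p : ℕ} [Fact p.Prime] (d m : ℕ) (hd : 0 < d) (A B : Finset (ZMod p))
    (hA : A.card = m + 1) (hN : d + m < p)
    (h : ∀ a ∈ A, ∀ b ∈ B, (b + a) ^ d = 1) : (m + 1) * B.card ≤ d := by
  classical
  obtain ⟨c, hc⟩ : ∃ c : ZMod p → ZMod p, ∀ P : Polynomial (ZMod p), P.degree < (m + 1 : ℕ) →
      ∑ i ∈ A, c i * P.eval i = P.coeff m := by
    refine ⟨fun i => (∏ j ∈ A.erase i, (i - j))⁻¹, fun P hP => ?_⟩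
    have := Lagrange.coeff_eq_sum (s := A) (v := id) (Function.injective_id.injOn) (P := P)
      (by rw [hA]; exact hP)
    rw [hA] at this
    simp only [id, Nat.add_sub_cancel] at this
    rw [this]
    exact Finset.sum_congr rfl fun i _ => by rw [div_eq_mul_inv, mul_comm]
  -- consequence for powers of shifts
  have hc' : ∀ (b : ZMod p) (k : ℕ), k ≤ m →
      ∑ i ∈ A, c i * (b + i) ^ k = if k = m then 1 else 0 := by
    intro b k hk
    have hmon : ((Polynomial.X + Polynomial.C b) ^ k : Polynomial (ZMod p)).Monic :=
      (Polynomial.monic_X_add_C b).pow k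
    have hdeg : ((Polynomial.X + Polynomial.C b) ^ k : Polynomial (ZMod p)).natDegree = k := by
      simp [Polynomial.natDegree_pow]
    have h1 := hc ((Polynomial.X + Polynomial.C b) ^ k) (by
      rw [Polynomial.degree_eq_natDegree hmon.ne_zero, hdeg]
      exact_mod_cast Nat.lt_succ_of_le hk)
    simp only [Polynomial.eval_pow, Polynomial.eval_add, Polynomial.eval_X,
      Polynomial.eval_C] at h1
    rw [show ∑ i ∈ A, c i * (b + i) ^ k = ∑ i ∈ A, c i * (i + b) ^ k from
      Finset.sum_congr rfl fun i _ => by rw [add_comm], h1]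
    split_ifs with hkm
    · subst hkm
      have := hmon.coeff_natDegree
      rwa [hdeg] at this
    · exact Polynomial.coeff_eq_zero_of_natDegree_lt (by rw [hdeg]; omega)
  let F : Polynomial (ZMod p) :=
    ∑ i ∈ A, Polynomial.C (c i) * (Polynomial.X + Polynomial.C i) ^ (d + m) - 1
  have hcoeff : ∀ k, F.coeff k =
      (∑ i ∈ A, c i * (0 + i) ^ (d + m - k)) * ((d + m).choose k : ZMod p)
        - if k = 0 then 1 else 0 := by
    intro k
    simp only [F, Polynomial.coeff_sub, Polynomial.finsetSum_coeff, Polynomial.coeff_C_mul,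
      Polynomial.coeff_X_add_C_pow, Polynomial.coeff_one, Finset.sum_mul, zero_add, mul_assoc]
  have hFdeg : F.natDegree ≤ d := by
    rw [Polynomial.natDegree_le_iff_coeff_eq_zero]
    intro k hk
    rw [hcoeff, if_neg (by omega)]
    by_cases hk2 : k ≤ d + m
    · rw [hc' 0 _ (by omega), if_neg (by omega)]; simp
    · rw [Nat.choose_eq_zero_of_lt (by omega)]; simp
  have hF0 : F ≠ 0 := by
    intro h0
    have h1 := hcoeff d
    rw [h0, if_neg (by omega), Nat.add_sub_cancel_left, hc' 0 m le_rfl, if_pos rfl] at h1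
    simp only [Polynomial.coeff_zero, one_mul, sub_zero] at h1
    have h2 := (ZMod.natCast_eq_zero_iff _ _).1 h1.symm
    have h3 : p ∣ (d + m).factorial := by
      rw [← Nat.choose_mul_factorial_mul_factorial (Nat.le_add_right d m), mul_assoc]
      exact Dvd.dvd.mul_right h2 _
    have := (Nat.Prime.dvd_factorial (Fact.out : p.Prime)).1 h3
    omega
  have hdvd : ∀ b ∈ B, (Polynomial.X - Polynomial.C b) ^ (m + 1) ∣ F := by
    intro b hb
    rw [Polynomial.X_sub_C_pow_dvd_iff, Polynomial.X_pow_dvd_iff]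
    intro k hk
    have hcomp : F.comp (Polynomial.X + Polynomial.C b) =
        ∑ i ∈ A, Polynomial.C (c i) * (Polynomial.X + Polynomial.C (b + i)) ^ (d + m) - 1 := by
      simp only [F, Polynomial.comp, Polynomial.eval₂_sub, Polynomial.eval₂_finsetSum,
        Polynomial.eval₂_mul, Polynomial.eval₂_C, Polynomial.eval₂_pow, Polynomial.eval₂_add,
        Polynomial.eval₂_X, Polynomial.eval₂_one, Polynomial.C_add, add_assoc]
    have hs : ∑ i ∈ A, c i * (b + i) ^ (d + m - k) = ∑ i ∈ A, c i * (b + i) ^ (m - k) := by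
      refine Finset.sum_congr rfl fun i hi => ?_
      rw [show d + m - k = d + (m - k) by omega, pow_add, h i hi b hb, one_mul]
    rw [hcomp]
    simp only [Polynomial.coeff_sub, Polynomial.finsetSum_coeff, Polynomial.coeff_C_mul,
      Polynomial.coeff_X_add_C_pow, Polynomial.coeff_one, ← mul_assoc]
    rw [← Finset.sum_mul, hs, hc' b _ (by omega)]
    by_cases hk0 : k = 0
    · simp [hk0]
    · rw [if_neg (by omega), if_neg hk0]; simp
  have hprod : ∏ b ∈ B, (Polynomial.X - Polynomial.C b) ^ (m + 1) ∣ F := by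
    refine Finset.prod_dvd_of_coprime ?_ hdvd
    intro x _ y _ hxy
    exact (Polynomial.pairwise_coprime_X_sub_C (Function.injective_id) hxy).pow
  have hle := Polynomial.natDegree_le_of_dvd hprod hF0
  rw [Polynomial.natDegree_prod _ _ (fun b _ => pow_ne_zero _ (Polynomial.X_sub_C_ne_zero b))] at hle
  simp only [Polynomial.natDegree_pow, Polynomial.natDegree_X_sub_C, Finset.sum_const,
    smul_eq_mul, mul_one] at hle
  rw [mul_comm]
  exact hle.trans hFdeg

theorem Rp_lower {p : ℕ} [Fact p.Prime] : p - 1 ≤ 2 * (Rp p).card := by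
  classical
  have h := Finset.card_le_mul_card_image_of_maps_to (f := fun x : ZMod p => x ^ 2)
    (s := Finset.univ.erase 0) (t := Rp p) (by
      intro a ha
      have ha0 : a ≠ 0 := by simpa using ha
      simp only [Rp, Finset.mem_filter, Finset.mem_univ, true_and]
      exact ⟨pow_ne_zero 2 ha0, ⟨a, sq a⟩⟩) 2 (by
      intro b hb
      simp only [Rp, Finset.mem_filter, Finset.mem_univ, true_and] at hb
      obtain ⟨_, r, rfl⟩ := hb
      refine (Finset.card_le_card (t := {r, -r}) ?_).trans Finset.card_le_two
      intro x hx
      have hx2 := (Finset.mem_filter.1 hx).2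
      simp only [← sq] at hx2
      simpa using sq_eq_sq_iff_eq_or_eq_neg.1 hx2)
  rwa [Finset.card_erase_of_mem (Finset.mem_univ _), Finset.card_univ, ZMod.card] at h

theorem card_mul {p : ℕ} [Fact p.Prime] (hp : p ≠ 2) (A B : Finset (ZMod p))
    (hA : 2 ≤ A.card) (hAB : A.card ≤ B.card) (h : A + B = Rp p) :
    2 * (A.card * B.card) = p - 1 := by
  classical
  have hodd : p % 2 = 1 := (Fact.out : p.Prime).mod_two_eq_one_iff_ne_two.2 hp
  have hp2 := (Fact.out : p.Prime).two_le
  have hlow := Rp_lower (p := p)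
  have hle : (A + B).card ≤ A.card * B.card := Finset.card_add_le
  rw [h] at hle
  have hpow : ∀ a ∈ A, ∀ b ∈ B, (b + a) ^ (p / 2) = 1 := by
    intro a ha b hb
    have : a + b ∈ Rp p := h ▸ Finset.add_mem_add ha hb
    simp only [Rp, Finset.mem_filter, Finset.mem_univ, true_and] at this
    rw [add_comm]
    exact (ZMod.euler_criterion p this.1).1 this.2
  obtain ⟨b, hb⟩ : B.Nonempty := Finset.card_pos.1 (by omega)
  have hAd : A.card ≤ p / 2 := by
    have h1 : (A.image (fun a => b + a)).card = A.card :=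
      Finset.card_image_of_injective _ (add_right_injective b)
    rw [← h1]
    refine le_trans (Finset.card_le_card (t := (Polynomial.nthRoots (p / 2) (1 : ZMod p)).toFinset)
      ?_) ((Multiset.toFinset_card_le _).trans (Polynomial.card_nthRoots _ _))
    intro x hx
    obtain ⟨a, ha, rfl⟩ := Finset.mem_image.1 hx
    rw [Multiset.mem_toFinset, Polynomial.mem_nthRoots (by omega)]
    exact hpow a ha b hb
  have hmain := hanson_petridis (p / 2) (A.card - 1) (by omega) A B (by omega) (by omega) hpow
  rw [show A.card - 1 + 1 = A.card by omega] at hmain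
  omega

theorem stmt_15 :
    ∃ p₀ : ℕ, ∀ (p : ℕ) [Fact p.Prime], p₀ ≤ p → p ≠ 2 →
      ∀ (A B : Finset (ZMod p)) (δ : ℝ), 2 ≤ A.card → A.card ≤ B.card →
        (1 : ℝ) / 8 < δ → δ ≤ 1 → (A.card : ℝ) = δ * B.card → A + B = Rp p →
        (Real.sqrt (δ * ((p : ℝ) - 1) / 2) ≤ A.card ∧
          (A.card : ℝ) ≤ min (2 * δ) (Real.sqrt δ) * Real.sqrt ((p : ℝ) - 1)) ∧
        (Real.sqrt (((p : ℝ) - 1) / (2 * δ)) ≤ B.card ∧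
          (B.card : ℝ) ≤ min 2 (1 / Real.sqrt δ) * Real.sqrt ((p : ℝ) - 1)) := by
  refine ⟨0, ?_⟩
  intro p _ _ hp A B δ hA hAB hδ hδ1 hAδ h
  have hp1 := (Fact.out : p.Prime).one_le
  have hm := card_mul hp A B hA hAB h
  have hq : (2 : ℝ) * (A.card * B.card) = (p : ℝ) - 1 := by
    have : ((2 * (A.card * B.card) : ℕ) : ℝ) = ((p - 1 : ℕ) : ℝ) := by rw [hm]
    push_cast [Nat.cast_sub hp1] at this
    exact this
  rw [← hq, hAδ]
  have hb0 : (0 : ℝ) ≤ B.card := Nat.cast_nonneg _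
  generalize (B.card : ℝ) = b at hb0
  have hδ0 : 0 < δ := by linarith
  have hs0 : 0 < Real.sqrt δ := Real.sqrt_pos.2 hδ0
  have hss : Real.sqrt δ * Real.sqrt δ = δ := Real.mul_self_sqrt hδ0.le
  have hb2 : 0 ≤ b ^ 2 := sq_nonneg b
  -- the two key upper bounds
  have hB1 : b ≤ 2 * Real.sqrt (2 * (δ * b * b)) := by
    have : b / 2 ≤ Real.sqrt (2 * (δ * b * b)) := Real.le_sqrt_of_sq_le (by nlinarith)
    linarith
  have hB2 : Real.sqrt δ * b ≤ Real.sqrt (2 * (δ * b * b)) := by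
    refine Real.le_sqrt_of_sq_le ?_
    have : (Real.sqrt δ * b) ^ 2 = δ * b ^ 2 := by rw [mul_pow, sq (Real.sqrt δ), hss]
    rw [this]; nlinarith [mul_nonneg hδ0.le hb2]
  refine ⟨⟨?_, ?_⟩, ⟨?_, ?_⟩⟩
  · rw [show δ * (2 * (δ * b * b)) / 2 = (δ * b) ^ 2 by ring, Real.sqrt_sq (by positivity)]
  · rcases min_choice (2 * δ) (Real.sqrt δ) with e | e <;> rw [e]
    · nlinarith
    · calc δ * b = Real.sqrt δ * (Real.sqrt δ * b) := by rw [← mul_assoc, hss]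
        _ ≤ _ := mul_le_mul_of_nonneg_left hB2 hs0.le
  · rw [show 2 * (δ * b * b) / (2 * δ) = b ^ 2 by field_simp, Real.sqrt_sq hb0]
  · rcases min_choice 2 (1 / Real.sqrt δ) with e | e <;> rw [e]
    · exact hB1
    · rw [one_div_mul_eq_div, le_div_iff₀ hs0, mul_comm]
      exact hB2
end
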